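/- In the residual Selmer setting, assume hypotheses (DU1) and (LS1). Then the core graph is path-connected, and it contains both vertices n with ρ(n) = 0 and vertices n with ρ(n) = 1. -/

import Mathlib

/-- The Selmer subspace attached to a finite subset `n ⊆ L`: vectors killed by `o ℓ`
for all `ℓ ∉ n` and by `u ℓ` for all `ℓ ∈ n`. -/
def resSel {K V L : Type*} [Field K] [AddCommGroup V] [Module K V]
    (u o : L → (V →ₗ[K] K)) (n : Finset L) : Submodule K V :=
  (⨅ (ℓ : L) (_ : ℓ ∉ n), LinearMap.ker (o ℓ)) ⊓ (⨅ ℓ ∈ n, LinearMap.ker (u ℓ))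

/-- Two finite subsets of `L` are adjacent if one is obtained from the other by
inserting a single new element of `L`. -/
def resAdj {L : Type*} [DecidableEq L] (n n' : Finset L) : Prop :=
  (∃ ℓ ∉ n, n' = insert ℓ n) ∨ (∃ ℓ ∉ n', n = insert ℓ n')

section Helpers

variable {K V L : Type*} [Field K] [AddCommGroup V] [Module K V]

theorem mem_resSel {u o : L → (V →ₗ[K] K)} {n : Finset L} {x : V} :
    x ∈ resSel u o n ↔ (∀ ℓ, ℓ ∉ n → o ℓ x = 0) ∧ ∀ ℓ ∈ n, u ℓ x = 0 := by
  simp [resSel]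

theorem finrank_inf_ker_add_one (A : Submodule K V) [FiniteDimensional K A] (f : V →ₗ[K] K)
    (h : ∃ x ∈ A, f x ≠ 0) :
    Module.finrank K (A ⊓ LinearMap.ker f : Submodule K V) + 1 = Module.finrank K A := by
  obtain ⟨x, hx, hfx⟩ := h
  have hne : f.domRestrict A ≠ 0 := fun h0 => hfx (by
    simpa using LinearMap.congr_fun h0 (⟨x, hx⟩ : A))
  have key := Module.Dual.finrank_ker_add_one_of_ne_zero (f := f.domRestrict A) hne
  have hker : LinearMap.ker (f.domRestrict A) = (LinearMap.ker f).comap A.subtype := rfl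
  rw [← key, hker, ← Submodule.map_comap_subtype,
    LinearEquiv.finrank_eq (Submodule.equivMapOfInjective A.subtype A.injective_subtype _)]

variable [DecidableEq L]

theorem resSel_inf_ker_eq (u o : L → (V →ₗ[K] K)) {n : Finset L} {ℓ : L} (hℓ : ℓ ∉ n) :
    resSel u o n ⊓ LinearMap.ker (u ℓ) = resSel u o (insert ℓ n) ⊓ LinearMap.ker (o ℓ) := by
  ext x
  simp only [Submodule.mem_inf, mem_resSel, LinearMap.mem_ker, Finset.mem_insert]
  grind

/-- Inserting a new element either cuts the Selmer space down to a hyperplane, or embeds it as a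
hyperplane. -/
theorem resSel_insert_cases {u o : L → (V →ₗ[K] K)}
    (hfin : ∀ n : Finset L, FiniteDimensional K (resSel u o n))
    {n : Finset L} {ℓ : L} (hℓ : ℓ ∉ n)
    (hDU1 : Xor (∃ x ∈ resSel u o n, u ℓ x ≠ 0) (∃ x ∈ resSel u o (insert ℓ n), o ℓ x ≠ 0)) :
    (resSel u o (insert ℓ n) ≤ resSel u o n ∧
      Module.finrank K (resSel u o (insert ℓ n)) + 1 = Module.finrank K (resSel u o n)) ∨
    (resSel u o n ≤ resSel u o (insert ℓ n) ∧
      Module.finrank K (resSel u o n) + 1 = Module.finrank K (resSel u o (insert ℓ n))) := by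
  have := hfin n
  have := hfin (insert ℓ n)
  have heq := resSel_inf_ker_eq u o hℓ
  rcases hDU1 with ⟨h, h'⟩ | ⟨h, h'⟩ <;> push Not at h'
  · have hle : resSel u o (insert ℓ n) ≤ LinearMap.ker (o ℓ) := h'
    rw [inf_eq_left.2 hle] at heq
    have hrank := finrank_inf_ker_add_one _ _ h
    rw [heq] at hrank
    exact Or.inl ⟨heq ▸ inf_le_left, hrank⟩
  · have hle : resSel u o n ≤ LinearMap.ker (u ℓ) := h'
    rw [inf_eq_left.2 hle] at heq
    have hrank := finrank_inf_ker_add_one _ _ h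
    rw [← heq] at hrank
    exact Or.inr ⟨heq.symm ▸ inf_le_left, hrank⟩

theorem resAdj_symmDiff_singleton (n : Finset L) (ℓ : L) : resAdj n (symmDiff n {ℓ}) := by
  by_cases h : ℓ ∈ n
  · refine Or.inr ⟨ℓ, by simp [Finset.mem_symmDiff, h], ?_⟩
    ext x
    simp only [Finset.mem_insert, Finset.mem_symmDiff, Finset.mem_singleton]
    grind
  · refine Or.inl ⟨ℓ, h, ?_⟩
    ext x
    simp only [Finset.mem_insert, Finset.mem_symmDiff, Finset.mem_singleton]
    grind

theorem resAdj.symm {n n' : Finset L} (h : resAdj n n') : resAdj n' n := Or.symm h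

theorem resSel_cases_of_resAdj {u o : L → (V →ₗ[K] K)}
    (hfin : ∀ n : Finset L, FiniteDimensional K (resSel u o n))
    (hDU1 : ∀ (n : Finset L) (ℓ : L), ℓ ∉ n →
      Xor (∃ x ∈ resSel u o n, u ℓ x ≠ 0) (∃ x ∈ resSel u o (insert ℓ n), o ℓ x ≠ 0))
    {n n' : Finset L} (h : resAdj n n') :
    Module.finrank K (resSel u o n') + 1 = Module.finrank K (resSel u o n) ∨
    (resSel u o n ≤ resSel u o n' ∧
      Module.finrank K (resSel u o n) + 1 = Module.finrank K (resSel u o n')) := by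
  rcases h with ⟨ℓ, hℓ, rfl⟩ | ⟨ℓ, hℓ, rfl⟩
  · exact (resSel_insert_cases hfin hℓ (hDU1 _ ℓ hℓ)).imp_left And.right
  · exact (resSel_insert_cases hfin hℓ (hDU1 _ ℓ hℓ)).symm.imp_left And.right

/-- A vector lying in `Sel(n)` and in `Sel(n ∆ {ℓ})` for all `ℓ ∈ n ∆ m` lies in `Sel(m)`. -/
theorem mem_resSel_of_forall_symmDiff {u o : L → (V →ₗ[K] K)} {n m : Finset L} {x : V}
    (hx : x ∈ resSel u o n)
    (h : ∀ ℓ ∈ symmDiff n m, x ∈ resSel u o (symmDiff n {ℓ})) : x ∈ resSel u o m := by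
  simp only [mem_resSel, Finset.mem_symmDiff, Finset.mem_singleton] at *
  grind

/-- The edge relation of the core graph. -/
def coreEdge (u o : L → (V →ₗ[K] K)) (n n' : Finset L) : Prop :=
  Module.finrank K (resSel u o n) ≤ 1 ∧ Module.finrank K (resSel u o n') ≤ 1 ∧ resAdj n n'

/-- Every core vertex is joined in the core graph to any vertex of rank zero. -/
theorem reflTransGen_coreEdge_of_finrank_eq_zero {u o : L → (V →ₗ[K] K)}
    (hfin : ∀ n : Finset L, FiniteDimensional K (resSel u o n))
    (hDU1 : ∀ (n : Finset L) (ℓ : L), ℓ ∉ n →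
      Xor (∃ x ∈ resSel u o n, u ℓ x ≠ 0) (∃ x ∈ resSel u o (insert ℓ n), o ℓ x ≠ 0))
    {n m : Finset L} (hn : Module.finrank K (resSel u o n) ≤ 1)
    (hm : Module.finrank K (resSel u o m) = 0) :
    Relation.ReflTransGen (coreEdge u o) n m := by
  by_cases hnm : n = m
  · exact hnm ▸ .refl
  obtain ⟨ℓ, hℓ, hrank⟩ : ∃ ℓ ∈ symmDiff n m,
      Module.finrank K (resSel u o (symmDiff n {ℓ})) ≤ 1 := by
    by_cases h0 : Module.finrank K (resSel u o n) = 0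
    · obtain ⟨ℓ, hℓ⟩ := Finset.symmDiff_nonempty.2 hnm
      have := resSel_cases_of_resAdj hfin hDU1 (resAdj_symmDiff_singleton n ℓ)
      exact ⟨ℓ, hℓ, by omega⟩
    · by_contra! hbig
      have := hfin m
      have hle : resSel u o n ≤ resSel u o m := fun x hx =>
        mem_resSel_of_forall_symmDiff hx fun ℓ hℓ => by
          have := hbig ℓ hℓ
          rcases resSel_cases_of_resAdj hfin hDU1 (resAdj_symmDiff_singleton n ℓ) with h | h
          · omega
          · exact h.1 hx
      have := Submodule.finrank_mono hle
      omega
  refine .head ⟨hn, hrank, resAdj_symmDiff_singleton n ℓ⟩ ?_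
  have : (symmDiff (symmDiff n {ℓ}) m).card < (symmDiff n m).card := by
    refine Finset.card_lt_card ⟨fun x => ?_, fun h => ?_⟩
    · simp only [Finset.mem_symmDiff, Finset.mem_singleton] at *
      grind
    · have := h hℓ
      simp only [Finset.mem_symmDiff, Finset.mem_singleton] at *
      grind
  exact reflTransGen_coreEdge_of_finrank_eq_zero hfin hDU1 hrank hm
termination_by (symmDiff n m).card

theorem exists_finrank_resSel_eq_zero {u o : L → (V →ₗ[K] K)}
    (hfin : ∀ n : Finset L, FiniteDimensional K (resSel u o n))
    (hDU1 : ∀ (n : Finset L) (ℓ : L), ℓ ∉ n →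
      Xor (∃ x ∈ resSel u o n, u ℓ x ≠ 0) (∃ x ∈ resSel u o (insert ℓ n), o ℓ x ≠ 0))
    (hLS1 : ∀ (n : Finset L), ∀ x ∈ resSel u o n, x ≠ 0 → ∃ ℓ : L, ℓ ∉ n ∧ u ℓ x ≠ 0) :
    ∃ n : Finset L, Module.finrank K (resSel u o n) = 0 := by
  obtain ⟨n, hn⟩ := exists_minimalFor_of_wellFoundedLT (fun _ : Finset L => True)
    (fun n => Module.finrank K (resSel u o n)) ⟨∅, trivial⟩
  refine ⟨n, by_contra fun h0 => ?_⟩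
  have := hfin n
  have hbot : resSel u o n ≠ ⊥ := fun h => h0 (Submodule.finrank_eq_zero.2 h)
  obtain ⟨x, hx, hx0⟩ := Submodule.exists_mem_ne_zero_of_ne_bot hbot
  obtain ⟨ℓ, hℓ, hu⟩ := hLS1 n x hx hx0
  rcases resSel_insert_cases hfin hℓ (hDU1 n ℓ hℓ) with h | h
  · have := hn.2 (j := insert ℓ n) trivial
    simp only at this
    omega
  · exact hu ((mem_resSel.1 (h.1 hx)).2 ℓ (Finset.mem_insert_self ℓ n))

end Helpers

theorem Relation.ReflTransGen.exists_fin_chain {α : Type*} {R : α → α → Prop} {a b : α}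
    (h : Relation.ReflTransGen R a b) :
    ∃ (r : ℕ) (c : Fin (r + 1) → α), c 0 = a ∧ c (Fin.last r) = b ∧
      ∀ i : Fin r, R (c i.castSucc) (c i.succ) := by
  induction h using Relation.ReflTransGen.head_induction_on with
  | refl => exact ⟨0, fun _ => b, rfl, rfl, fun i => i.elim0⟩
  | @head a a' haa' _ ih =>
    obtain ⟨r, c, h0, hlast, hc⟩ := ih
    refine ⟨r + 1, Fin.cons a c, rfl, by rw [← Fin.succ_last, Fin.cons_succ, hlast], ?_⟩
    refine Fin.cases ?_ fun i => ?_
    · simpa [h0] using haa'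
    · rw [← Fin.succ_castSucc, Fin.cons_succ, Fin.cons_succ]
      exact hc i

/-- In the residual Selmer setting, under (DU1) and (LS1): the core graph (vertices the
finite `n ⊆ L` with `ρ(n) ≤ 1`, edges given by insertion of one element) is
path-connected, and it contains vertices with `ρ = 0` and vertices with `ρ = 1`. -/
theorem resSel_core_graph_connected
    {K V L : Type*} [Field K] [AddCommGroup V] [Module K V] [Infinite L] [DecidableEq L]
    (u o : L → (V →ₗ[K] K))
    (hfin : ∀ n : Finset L, FiniteDimensional K (resSel u o n))
    -- (DU1)
    (hDU1 : ∀ (n : Finset L) (ℓ : L), ℓ ∉ n →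
      Xor' (∃ x ∈ resSel u o n, u ℓ x ≠ 0)
           (∃ x ∈ resSel u o (insert ℓ n), o ℓ x ≠ 0))
    -- (LS1)
    (hLS1 : ∀ (n : Finset L), ∀ x ∈ resSel u o n, x ≠ 0 →
      ∃ ℓ : L, ℓ ∉ n ∧ u ℓ x ≠ 0) :
    (∀ n n' : Finset L,
      Module.finrank K (resSel u o n) ≤ 1 →
      Module.finrank K (resSel u o n') ≤ 1 →
      ∃ (r : ℕ) (c : Fin (r + 1) → Finset L),
        c 0 = n ∧ c (Fin.last r) = n' ∧
        (∀ i : Fin (r + 1), Module.finrank K (resSel u o (c i)) ≤ 1) ∧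
        (∀ i : Fin r, resAdj (c i.castSucc) (c i.succ))) ∧
    (∃ n : Finset L, Module.finrank K (resSel u o n) = 0) ∧
    (∃ n : Finset L, Module.finrank K (resSel u o n) = 1) := by
  obtain ⟨m, hm⟩ := exists_finrank_resSel_eq_zero hfin hDU1 hLS1
  refine ⟨fun n n' hn hn' => ?_, ⟨m, hm⟩, ?_⟩
  · have hsymm : Std.Symm (coreEdge u o) := ⟨fun _ _ h => ⟨h.2.1, h.1, h.2.2.symm⟩⟩
    have hpath := (reflTransGen_coreEdge_of_finrank_eq_zero hfin hDU1 hn hm).trans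
      (Std.Symm.symm _ _ (reflTransGen_coreEdge_of_finrank_eq_zero hfin hDU1 hn' hm))
    obtain ⟨r, c, h0, hlast, hc⟩ := hpath.exists_fin_chain
    exact ⟨r, c, h0, hlast, Fin.cases (h0 ▸ hn) fun i => (hc i).2.1, fun i => (hc i).2.2⟩
  · obtain ⟨ℓ, hℓ⟩ := Infinite.exists_notMem_finset m
    have := resSel_insert_cases hfin hℓ (hDU1 m ℓ hℓ)
    exact ⟨insert ℓ m, by omega⟩
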